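/- Fix p ∈ (0,1] and for each n ≥ 3 fix three distinct vertices s, a, b of ⃗G(n,p). If 0 < p < 1/2, then Cov({s↛a}, {b↛s}) < 0 for all sufficiently large n; if 1/2 < p ≤ 1, then Cov({s↛a}, {b↛s}) > 0 for all sufficiently large n. -/

import Mathlib

open Filter Real

/-- Edges of the complete graph on `Fin n`: ordered pairs `(u,v)` with `u < v`. -/
abbrev Edge (n : ℕ) : Type := {e : Fin n × Fin n // e.1 < e.2}

/-- A configuration of the random edge-orientation model: for each pair `u < v`,
`none` means no edge, `some true` means the directed edge `u → v`, and
`some false` means the directed edge `v → u`. -/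
abbrev Config (n : ℕ) : Type := Edge n → Option Bool

/-- The directed edge relation determined by a configuration. -/
def DirEdge {n : ℕ} (f : Config n) (u v : Fin n) : Prop :=
  (∃ h : u < v, f ⟨(u, v), h⟩ = some true) ∨ (∃ h : v < u, f ⟨(v, u), h⟩ = some false)

/-- `Reaches f u v`: the configuration `f` contains a directed path from `u` to `v`
(paths of length `0` are allowed, so `Reaches f u u` always holds). -/
def Reaches {n : ℕ} (f : Config n) (u v : Fin n) : Prop :=
  Relation.ReflTransGen (DirEdge f) u v

/-- The probability of an event under a weight function on a finite sample space. -/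
noncomputable def prWeight {α : Type*} [Fintype α] (w : α → ℝ) (E : Set α) : ℝ :=
  ∑ x, E.indicator w x

/-- The weight of one edge state in `⃗G(n,p)`: no edge has probability `1 - p`
and each of the two orientations has probability `p/2`. -/
noncomputable def edgeWeight (p : ℝ) : Option Bool → ℝ
  | none => 1 - p
  | some _ => p / 2

/-- The probability of an event in the random directed graph `⃗G(n,p)`. -/
noncomputable def PrGnp (n : ℕ) (p : ℝ) (E : Set (Config n)) : ℝ :=
  prWeight (fun f => ∏ e : Edge n, edgeWeight p (f e)) E

/-- The number of present edges of a configuration. -/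
def edgeCount {n : ℕ} (f : Config n) : ℕ :=
  (Finset.univ.filter fun e : Edge n => (f e).isSome).card

/-- The probability of an event in the random directed graph `⃗G(n,m)`:
the underlying graph is uniform among the graphs with exactly `m` edges, and each
present edge is oriented in one of its two directions with probability `1/2`,
independently over edges. -/
noncomputable def PrGnm (n m : ℕ) (E : Set (Config n)) : ℝ :=
  prWeight (fun f => if edgeCount f = m
      then ((Nat.choose (Nat.choose n 2) m : ℝ) * 2 ^ m)⁻¹ else 0) E

section Probability

variable {N : ℕ} {p : ℝ}

lemma edgeWeight_nonneg (h0 : 0 ≤ p) (h1 : p ≤ 1) (o : Option Bool) : 0 ≤ edgeWeight p o := by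
  cases o <;> simp only [edgeWeight] <;> linarith

lemma PrGnp_mono (h0 : 0 ≤ p) (h1 : p ≤ 1) {E F : Set (Config N)} (h : E ⊆ F) :
    PrGnp N p E ≤ PrGnp N p F :=
  Finset.sum_le_sum fun f _ => Set.indicator_le_indicator_of_subset h
    (fun _ => Finset.prod_nonneg fun _ _ => edgeWeight_nonneg h0 h1 _) f

lemma PrGnp_nonneg (h0 : 0 ≤ p) (h1 : p ≤ 1) (E : Set (Config N)) : 0 ≤ PrGnp N p E :=
  Finset.sum_nonneg fun _ _ => Set.indicator_nonneg
    (fun _ _ => Finset.prod_nonneg fun _ _ => edgeWeight_nonneg h0 h1 _) _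

lemma PrGnp_union_add_inter (E F : Set (Config N)) :
    PrGnp N p (E ∪ F) + PrGnp N p (E ∩ F) = PrGnp N p E + PrGnp N p F := by
  simp only [PrGnp, prWeight, ← Finset.sum_add_distrib]
  exact Finset.sum_congr rfl fun f _ => Set.indicator_union_add_inter_apply _ E F f

lemma PrGnp_union_le (h0 : 0 ≤ p) (h1 : p ≤ 1) (E F : Set (Config N)) :
    PrGnp N p (E ∪ F) ≤ PrGnp N p E + PrGnp N p F := by
  have h := PrGnp_union_add_inter (p := p) E F
  have := PrGnp_nonneg h0 h1 (E ∩ F)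
  linarith

/-- Union bound over the indices satisfying `Q`. -/
lemma PrGnp_exists_le (h0 : 0 ≤ p) (h1 : p ≤ 1) {ι : Type*} [Fintype ι] (Q : ι → Prop)
    (E : ι → Set (Config N)) {c : ℝ} (hc : 0 ≤ c) (h : ∀ i, Q i → PrGnp N p (E i) ≤ c) :
    PrGnp N p {f | ∃ i, Q i ∧ f ∈ E i} ≤ Fintype.card ι * c := by
  classical
  have key : PrGnp N p {f | ∃ i, Q i ∧ f ∈ E i} ≤
      ∑ i, if Q i then PrGnp N p (E i) else 0 := by
    simp only [PrGnp, prWeight, ← Finset.sum_filter]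
    rw [Finset.sum_comm]
    refine Finset.sum_le_sum fun f _ => ?_
    have hw : ∀ g : Config N, 0 ≤ ∏ e : Edge N, edgeWeight p (g e) :=
      fun _ => Finset.prod_nonneg fun _ _ => edgeWeight_nonneg h0 h1 _
    by_cases hf : ∃ i, Q i ∧ f ∈ E i
    · obtain ⟨i, hQ, hi⟩ := hf
      rw [Set.indicator_of_mem (show f ∈ {f | ∃ i, Q i ∧ f ∈ E i} from ⟨i, hQ, hi⟩)]
      refine le_trans (le_of_eq ?_) (Finset.single_le_sum
        (f := fun i => (E i).indicator (fun g : Config N => ∏ e : Edge N, edgeWeight p (g e)) f)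
        (fun _ _ => Set.indicator_nonneg (fun g _ => hw g) _)
        (Finset.mem_filter.2 ⟨Finset.mem_univ i, hQ⟩))
      simp only [Set.indicator_of_mem hi]
    · rw [Set.indicator_of_notMem (by simpa using hf)]
      exact Finset.sum_nonneg fun _ _ => Set.indicator_nonneg (fun g _ => hw g) _
  refine key.trans ?_
  calc (∑ i, if Q i then PrGnp N p (E i) else 0) ≤ ∑ _i : ι, c := by
        refine Finset.sum_le_sum fun i _ => ?_
        split_ifs with hi
        exacts [h i hi, hc]
    _ = Fintype.card ι * c := by simp

/-- The event that none of the directed edges in `D` is present. -/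
def avoids (D : Finset (Fin N × Fin N)) : Set (Config N) :=
  {f | ∀ d ∈ D, ¬ DirEdge f d.1 d.2}

lemma mem_avoids_iff (D : Finset (Fin N × Fin N)) (f : Config N) :
    f ∈ avoids D ↔
      ∀ e : Edge N, ¬ (e.1 ∈ D ∧ f e = some true ∨ e.1.swap ∈ D ∧ f e = some false) := by
  constructor
  · rintro h e (⟨hD, he⟩ | ⟨hD, he⟩)
    · exact h _ hD (Or.inl ⟨e.2, he⟩)
    · exact h _ hD (Or.inr ⟨e.2, he⟩)
  · rintro h ⟨u, v⟩ hD (⟨hlt, he⟩ | ⟨hlt, he⟩)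
    · exact h ⟨(u, v), hlt⟩ (Or.inl ⟨hD, he⟩)
    · exact h ⟨(v, u), hlt⟩ (Or.inr ⟨hD, he⟩)

lemma PrGnp_avoids (D : Finset (Fin N × Fin N)) :
    PrGnp N p (avoids D) = ∏ e : Edge N,
      ((1 - p) + (if e.1 ∈ D then 0 else p / 2) + (if e.1.swap ∈ D then 0 else p / 2)) := by
  classical
  have h : ∀ e : Edge N,
      ((1 - p) + (if e.1 ∈ D then 0 else p / 2) + (if e.1.swap ∈ D then 0 else p / 2)) =
        ∑ o : Option Bool, if e.1 ∈ D ∧ o = some true ∨ e.1.swap ∈ D ∧ o = some false then 0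
          else edgeWeight p o := by
    intro e
    simp [Fintype.sum_option, edgeWeight]
    ring
  simp only [h]
  rw [Finset.prod_univ_sum, Fintype.piFinset_univ]
  refine Finset.sum_congr rfl fun f _ => ?_
  by_cases hf : f ∈ avoids D
  · rw [Set.indicator_of_mem hf]
    rw [mem_avoids_iff] at hf
    exact Finset.prod_congr rfl fun e _ => (if_neg (hf e)).symm
  · rw [Set.indicator_of_notMem hf]
    rw [mem_avoids_iff] at hf
    push Not at hf
    obtain ⟨e, he⟩ := hf
    symm
    exact Finset.prod_eq_zero (Finset.mem_univ e) (if_pos he)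

lemma prod_edge_ite_eq_pow_card (t : ℝ) (D : Finset (Fin N × Fin N)) (hD : ∀ d ∈ D, d.1 ≠ d.2) :
    ∏ e : Edge N, ((if e.1 ∈ D then t else 1) * (if e.1.swap ∈ D then t else 1)) =
      t ^ D.card := by
  classical
  have h1 : ∏ e : Edge N, (if e.1 ∈ D then t else 1) =
      ∏ d ∈ Finset.univ.filter (fun d : Fin N × Fin N => d.1 < d.2), if d ∈ D then t else 1 :=
    (Finset.prod_subtype (p := fun d : Fin N × Fin N => d.1 < d.2) _ (by simp)
      (fun d => if d ∈ D then t else 1)).symm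
  have h2 : ∏ e : Edge N, (if e.1.swap ∈ D then t else 1) =
      ∏ d ∈ Finset.univ.filter (fun d : Fin N × Fin N => ¬ d.1 < d.2),
        if d ∈ D then t else 1 := by
    rw [← Finset.prod_subtype (Finset.univ.filter (fun d : Fin N × Fin N => d.1 < d.2)) (by simp)
      (fun d => if d.swap ∈ D then t else 1)]
    have h3 : ∏ d ∈ Finset.univ.filter (fun d : Fin N × Fin N => d.1 < d.2),
        (if d.swap ∈ D then t else 1) =
        ∏ d ∈ Finset.univ.filter (fun d : Fin N × Fin N => d.2 < d.1),
          if d ∈ D then t else 1 :=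
      Finset.prod_nbij' Prod.swap Prod.swap (by simp) (by simp) (by simp) (by simp) (by simp)
    rw [h3]
    refine Finset.prod_subset (fun d => by simpa using le_of_lt) fun d hd hd' => if_neg fun hdD => ?_
    simp only [Finset.mem_filter, Finset.mem_univ, true_and, not_lt] at hd hd'
    exact hD d hdD (le_antisymm hd' hd)
  rw [Finset.prod_mul_distrib, h1, h2, Finset.prod_filter_mul_prod_filter_not,
    Finset.prod_ite_mem, Finset.univ_inter, Finset.prod_const]

/-- A set of directed edges without antiparallel pairs is avoided with probability
`(1 - p / 2) ^ |D|`. -/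
lemma PrGnp_avoids_eq_pow (D : Finset (Fin N × Fin N)) (hD : ∀ d ∈ D, d.1 ≠ d.2)
    (hsw : ∀ d ∈ D, d.swap ∉ D) : PrGnp N p (avoids D) = (1 - p / 2) ^ D.card := by
  rw [PrGnp_avoids, ← prod_edge_ite_eq_pow_card _ D hD]
  refine Finset.prod_congr rfl fun e _ => ?_
  by_cases h1 : e.1 ∈ D
  · simp only [h1, hsw _ h1, if_true, if_false]; ring
  · by_cases h2 : e.1.swap ∈ D <;> simp only [h1, h2, if_true, if_false] <;> ring

lemma PrGnp_avoids_le_of_symm (h1 : p ≤ 1) {t : ℝ} (ht : 1 - p ≤ t ^ 2)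
    (D : Finset (Fin N × Fin N)) (hD : ∀ d ∈ D, d.1 ≠ d.2)
    (hsw : ∀ d, d.swap ∈ D ↔ d ∈ D) : PrGnp N p (avoids D) ≤ t ^ D.card := by
  rw [PrGnp_avoids, ← prod_edge_ite_eq_pow_card _ D hD]
  refine Finset.prod_le_prod (fun e _ => ?_) fun e _ => ?_
  · by_cases h : e.1 ∈ D <;> simp only [hsw, h, if_true, if_false] <;> linarith
  · by_cases h : e.1 ∈ D <;> simp only [hsw, h, if_true, if_false] <;> nlinarith

end Probability

section Events

variable {N : ℕ} {p : ℝ}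

/-- The pair `(x, v)` or `(v, x)`, according to the sign. -/
def orientPair (c : Bool) (x v : Fin N) : Fin N × Fin N :=
  if c then (x, v) else (v, x)

/-- All out-edges (for `c = true`) or all in-edges (for `c = false`) of `x` that are present
have their other endpoint in `W`. -/
def Quiet (f : Config N) (c : Bool) (x : Fin N) (W : Finset (Fin N)) : Prop :=
  ∀ v ∉ W, ¬ DirEdge f (orientPair c x v).1 (orientPair c x v).2

lemma quiet_true {f : Config N} {x : Fin N} {W : Finset (Fin N)} :
    Quiet f true x W ↔ ∀ v ∉ W, ¬ DirEdge f x v := Iff.rfl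

lemma quiet_false {f : Config N} {x : Fin N} {W : Finset (Fin N)} :
    Quiet f false x W ↔ ∀ v ∉ W, ¬ DirEdge f v x := Iff.rfl

lemma Quiet.mono {f : Config N} {c : Bool} {x : Fin N} {W W' : Finset (Fin N)}
    (h : Quiet f c x W) (hW : W ⊆ W') : Quiet f c x W' :=
  fun v hv => h v fun hv' => hv (hW hv')

/-- Some `j` distinct vertices have all their out-edges or all their in-edges
confined to a set of at most `M` vertices. -/
def sparse (N j M : ℕ) : Set (Config N) :=
  {f | ∃ W : Finset (Fin N), W.card ≤ M ∧ ∃ x : Fin j → Fin N, Function.Injective x ∧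
    (∀ i, x i ∈ W) ∧ ∃ σ : Fin j → Bool, ∀ i, Quiet f (σ i) (x i) W}

/-- Some vertex has all its edges confined to a set of at most `M` vertices. -/
def nearlyIsolated (N M : ℕ) : Set (Config N) :=
  {f | ∃ W : Finset (Fin N), W.card ≤ M ∧ ∃ x ∈ W, Quiet f true x W ∧ Quiet f false x W}

/-- No edge leaves some set having at least `K` vertices inside and outside. -/
def midCut (N K : ℕ) : Set (Config N) :=
  {f | ∃ S : Finset (Fin N), (K ≤ S.card ∧ K ≤ Sᶜ.card) ∧ f ∈ avoids (S ×ˢ Sᶜ)}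

lemma avoids_anti {D D' : Finset (Fin N × Fin N)} (h : D ⊆ D') : avoids D' ⊆ avoids D :=
  fun _ hf d hd => hf d (h hd)

lemma exists_image_superset [Nonempty (Fin N)] {W : Finset (Fin N)} {M : ℕ} (hW : W.card ≤ M) :
    ∃ g : Fin M → Fin N, W ⊆ Finset.univ.image g := by
  obtain ⟨e⟩ := Function.Embedding.nonempty_of_card_le
    (α := W) (β := Fin M) (by simpa using hW)
  refine ⟨Function.extend e Subtype.val fun _ => Classical.arbitrary _, fun w hw => ?_⟩
  exact Finset.mem_image.2 ⟨e ⟨w, hw⟩, Finset.mem_univ _, e.injective.extend_apply _ _ _⟩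

lemma card_image_univ_le {M : ℕ} (g : Fin M → Fin N) : (Finset.univ.image g).card ≤ M := by
  simpa using Finset.card_image_le (s := Finset.univ) (f := g)

/-- The directed edges whose absence is expressed by `∀ i, Quiet f (σ i) (x i) W`. -/
def quietPairs {j : ℕ} (x : Fin j → Fin N) (σ : Fin j → Bool) (W : Finset (Fin N)) :
    Finset (Fin N × Fin N) :=
  ((Finset.univ : Finset (Fin j)) ×ˢ Wᶜ).image fun q => orientPair (σ q.1) (x q.1) q.2

lemma mem_avoids_quietPairs {j : ℕ} {x : Fin j → Fin N} {σ : Fin j → Bool}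
    {W : Finset (Fin N)} {f : Config N} :
    f ∈ avoids (quietPairs x σ W) ↔ ∀ i, Quiet f (σ i) (x i) W := by
  constructor
  · intro h i v hv
    exact h _ (Finset.mem_image.2 ⟨(i, v), by simpa using hv, rfl⟩)
  · intro h d hd
    obtain ⟨⟨i, v⟩, hq, rfl⟩ := Finset.mem_image.1 hd
    exact h i v (by simpa using hq)

lemma PrGnp_avoids_quietPairs {j : ℕ} {x : Fin j → Fin N} (hx : Function.Injective x)
    (σ : Fin j → Bool) {W : Finset (Fin N)} (hW : ∀ i, x i ∈ W) :
    PrGnp N p (avoids (quietPairs x σ W)) = (1 - p / 2) ^ (j * (N - W.card)) := by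
  have hne : ∀ i, ∀ v ∉ W, x i ≠ v := fun i v hv h => hv (h ▸ hW i)
  rw [PrGnp_avoids_eq_pow]
  · congr 1
    rw [quietPairs, Finset.card_image_of_injOn]
    · simp [Finset.card_compl]
    · rintro ⟨i, v⟩ hi ⟨k, w⟩ hk h
      simp only [Finset.coe_product, Set.mem_prod, Finset.mem_coe, Finset.mem_compl,
        Finset.mem_univ, true_and] at hi hk
      have h1 := hne i w hk
      have h2 := hne k v hi
      cases hi' : σ i <;> cases hk' : σ k <;>
        simp only [orientPair, hi', hk', if_true, if_false, Prod.mk.injEq,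
          Bool.false_eq_true] at h <;>
        grind [hx.eq_iff]
  · intro d hd
    obtain ⟨⟨i, v⟩, hq, rfl⟩ := Finset.mem_image.1 hd
    have := hne i v (by simpa using hq)
    cases hi' : σ i <;> simp [orientPair, this, this.symm]
  · intro d hd hd'
    obtain ⟨⟨i, v⟩, hq, rfl⟩ := Finset.mem_image.1 hd
    obtain ⟨⟨k, w⟩, hq', h⟩ := Finset.mem_image.1 hd'
    have h1 := hne i w (by simpa using hq')
    have h2 := hne k v (by simpa using hq)
    cases hi' : σ i <;> cases hk' : σ k <;>
      simp only [orientPair, hi', hk', if_true, if_false, Prod.mk.injEq, Prod.swap,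
        Bool.false_eq_true] at h <;>
      grind [hx.eq_iff]

lemma PrGnp_sparse_le [Nonempty (Fin N)] (h0 : 0 ≤ p) (h1 : p ≤ 1) (j M : ℕ) :
    PrGnp N p (sparse N j M) ≤
      (N : ℝ) ^ M * ((N : ℝ) ^ j * 2 ^ j) * (1 - p / 2) ^ (j * (N - M)) := by
  have hc : (0 : ℝ) ≤ (1 - p / 2) ^ (j * (N - M)) := pow_nonneg (by linarith) _
  have h := PrGnp_exists_le h0 h1
    (ι := (Fin M → Fin N) × (Fin j → Fin N) × (Fin j → Bool))
    (fun i => Function.Injective i.2.1 ∧ ∀ k, i.2.1 k ∈ Finset.univ.image i.1)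
    (fun i => avoids (quietPairs i.2.1 i.2.2 (Finset.univ.image i.1))) hc
    (fun i hi => by
      rw [PrGnp_avoids_quietPairs hi.1 _ hi.2]
      refine pow_le_pow_of_le_one (by linarith) (by linarith) (Nat.mul_le_mul_left _ ?_)
      have := card_image_univ_le i.1
      omega)
  refine (PrGnp_mono h0 h1 ?_).trans (h.trans_eq ?_)
  · rintro f ⟨W, hW, x, hx, hxW, σ, hσ⟩
    obtain ⟨g, hg⟩ := exists_image_superset hW
    exact ⟨(g, x, σ), ⟨hx, fun k => hg (hxW k)⟩,
      mem_avoids_quietPairs.2 fun i => (hσ i).mono hg⟩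
  · simp

lemma PrGnp_nearlyIsolated_le [Nonempty (Fin N)] (h0 : 0 ≤ p) (h1 : p ≤ 1) {t : ℝ}
    (ht0 : 0 ≤ t) (ht1 : t ≤ 1) (ht : 1 - p ≤ t ^ 2) (M : ℕ) :
    PrGnp N p (nearlyIsolated N M) ≤ (N : ℝ) ^ M * N * t ^ (2 * (N - M)) := by
  have hc : (0 : ℝ) ≤ t ^ (2 * (N - M)) := pow_nonneg ht0 _
  have h := PrGnp_exists_le h0 h1 (ι := (Fin M → Fin N) × Fin N)
    (fun i => i.2 ∈ Finset.univ.image i.1)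
    (fun i => avoids ({i.2} ×ˢ (Finset.univ.image i.1)ᶜ ∪ (Finset.univ.image i.1)ᶜ ×ˢ {i.2})) hc
    (fun i hi => by
      refine (PrGnp_avoids_le_of_symm h1 ht _ ?_ ?_).trans ?_
      · rintro ⟨u, v⟩ hd
        simp only [Finset.mem_union, Finset.mem_product, Finset.mem_singleton,
          Finset.mem_compl] at hd
        rintro (rfl : u = v)
        grind
      · rintro ⟨u, v⟩
        simp only [Finset.mem_union, Finset.mem_product, Finset.mem_singleton, Prod.swap,
          and_comm, or_comm]
      · refine pow_le_pow_of_le_one ht0 ht1 ?_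
        rw [Finset.card_union_of_disjoint]
        · have := card_image_univ_le i.1
          simp only [Finset.card_product, Finset.card_singleton, Finset.card_compl,
            Fintype.card_fin]
          omega
        · rw [Finset.disjoint_left]
          rintro ⟨u, v⟩ hd hd'
          simp only [Finset.mem_product, Finset.mem_singleton, Finset.mem_compl] at hd hd'
          grind)
  refine (PrGnp_mono h0 h1 ?_).trans (h.trans_eq ?_)
  · rintro f ⟨W, hW, x, hxW, hx, hx'⟩
    obtain ⟨g, hg⟩ := exists_image_superset hW
    refine ⟨(g, x), hg hxW, ?_⟩
    rintro ⟨u, v⟩ hd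
    simp only [Finset.mem_union, Finset.mem_product, Finset.mem_singleton,
      Finset.mem_compl] at hd
    rcases hd with ⟨rfl, hv⟩ | ⟨hu, rfl⟩
    · exact hx.mono hg v hv
    · exact hx'.mono hg u hu
  · simp

lemma PrGnp_midCut_le (h0 : 0 ≤ p) (h1 : p ≤ 1) (K : ℕ) :
    PrGnp N p (midCut N K) ≤ 2 ^ N * (1 - p / 2) ^ (K * (N - K)) := by
  have hc : (0 : ℝ) ≤ (1 - p / 2) ^ (K * (N - K)) := pow_nonneg (by linarith) _
  refine (PrGnp_exists_le h0 h1 (ι := Finset (Fin N)) (fun S => K ≤ S.card ∧ K ≤ Sᶜ.card)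
    (fun S => avoids (S ×ˢ Sᶜ)) hc fun S hS => ?_).trans_eq (by simp)
  rw [PrGnp_avoids_eq_pow]
  · refine pow_le_pow_of_le_one (by linarith) (by linarith) ?_
    rw [Finset.card_product]
    have hN := S.card_add_card_compl
    rw [Fintype.card_fin] at hN
    obtain ⟨i, hi⟩ := Nat.exists_eq_add_of_le hS.1
    obtain ⟨l, hl⟩ := Nat.exists_eq_add_of_le hS.2
    have : N - K = K + i + l := by omega
    rw [this, hi, hl]
    nlinarith [Nat.zero_le (i * l)]
  · rintro ⟨u, v⟩ hd
    simp only [Finset.mem_product, Finset.mem_compl] at hd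
    rintro (rfl : u = v)
    exact hd.2 hd.1
  · rintro ⟨u, v⟩ hd hd'
    simp only [Finset.mem_product, Finset.mem_compl, Prod.swap] at hd hd'
    exact hd.2 hd'.1

end Events

section Reachability

variable {N : ℕ}

lemma not_reaches_of_closed {f : Config N} {S : Finset (Fin N)} {u v : Fin N} (hu : u ∈ S)
    (hv : v ∉ S) (h : ∀ x ∈ S, ∀ y ∉ S, ¬ DirEdge f x y) : ¬ Reaches f u v := by
  intro hr
  refine absurd ?_ hv
  clear hv
  induction hr with
  | refl => exact hu
  | tail _ hxy ih => exact by_contra fun hy => h _ ih _ hy hxy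

lemma exists_closed_of_not_reaches {f : Config N} {u v : Fin N} (h : ¬ Reaches f u v) :
    ∃ S : Finset (Fin N), u ∈ S ∧ v ∉ S ∧ ∀ x ∈ S, ∀ y ∉ S, ¬ DirEdge f x y := by
  classical
  refine ⟨Finset.univ.filter (Reaches f u), Finset.mem_filter.2 ⟨Finset.mem_univ _, .refl⟩,
    by simpa using h, fun x hx y hy hxy => ?_⟩
  simp only [Finset.mem_filter, Finset.mem_univ, true_and] at hx hy
  exact hy (hx.tail hxy)

lemma card_lt_or_of_notMem_midCut {f : Config N} {K : ℕ} (hf : f ∉ midCut N K)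
    {S : Finset (Fin N)} (hS : ∀ x ∈ S, ∀ y ∉ S, ¬ DirEdge f x y) :
    S.card < K ∨ Sᶜ.card < K := by
  by_contra! h
  refine hf ⟨S, h, ?_⟩
  rintro ⟨x, y⟩ hd
  simp only [Finset.mem_product, Finset.mem_compl] at hd
  exact hS x hd.1 y hd.2

lemma mem_sparse_two {f : Config N} {M : ℕ} {W : Finset (Fin N)} (hW : W.card ≤ M)
    {x y : Fin N} (hxy : x ≠ y) (hx : x ∈ W) (hy : y ∈ W) (c d : Bool)
    (hc : Quiet f c x W) (hd : Quiet f d y W) : f ∈ sparse N 2 M := by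
  refine ⟨W, hW, ![x, y], ?_, ?_, ![c, d], ?_⟩
  · intro i k h
    fin_cases i <;> fin_cases k <;> simp_all
  · simp [Fin.forall_fin_two, hx, hy]
  · simp [Fin.forall_fin_two, hc, hd]

lemma mem_sparse_three {f : Config N} {M : ℕ} {W : Finset (Fin N)} (hW : W.card ≤ M)
    {x y z : Fin N} (hxy : x ≠ y) (hxz : x ≠ z) (hyz : y ≠ z) (hx : x ∈ W) (hy : y ∈ W)
    (hz : z ∈ W) (c d e : Bool) (hc : Quiet f c x W) (hd : Quiet f d y W)
    (he : Quiet f e z W) : f ∈ sparse N 3 M := by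
  refine ⟨W, hW, ![x, y, z], ?_, ?_, ![c, d, e], ?_⟩
  · intro i k h
    fin_cases i <;> fin_cases k <;> simp_all
  · simp [Fin.forall_fin_succ, hx, hy, hz]
  · simp [Fin.forall_fin_succ, hc, hd, he]

/-- All out-edges of `s`. -/
def outStar (s : Fin N) : Finset (Fin N × Fin N) := {s} ×ˢ {s}ᶜ

/-- All in-edges of `a`. -/
def inStar (a : Fin N) : Finset (Fin N × Fin N) := {a}ᶜ ×ˢ {a}

/-- All out-edges of `s` and `b` except for `(s, b)`. -/
def outFork (s b : Fin N) : Finset (Fin N × Fin N) := {b} ×ˢ {b}ᶜ ∪ {s} ×ˢ {s, b}ᶜ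

/-- All in-edges of `s` and `a` except for `(a, s)`. -/
def inFork (s a : Fin N) : Finset (Fin N × Fin N) := {a}ᶜ ×ˢ {a} ∪ {s, a}ᶜ ×ˢ {s}

lemma mem_avoids_outStar {f : Config N} {s : Fin N} :
    f ∈ avoids (outStar s) ↔ ∀ v, v ≠ s → ¬ DirEdge f s v := by
  simp [avoids, outStar]

lemma mem_avoids_inStar {f : Config N} {a : Fin N} :
    f ∈ avoids (inStar a) ↔ ∀ v, v ≠ a → ¬ DirEdge f v a := by
  simp only [avoids, inStar, Set.mem_ofPred_eq, Prod.forall, Finset.mem_product,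
    Finset.mem_compl, Finset.mem_singleton]
  exact ⟨fun h v hv => h v a ⟨hv, rfl⟩, by rintro h v _ ⟨hv, rfl⟩; exact h v hv⟩

lemma mem_avoids_outFork {f : Config N} {s b : Fin N} :
    f ∈ avoids (outFork s b) ↔
      (∀ v, v ≠ b → ¬ DirEdge f b v) ∧ ∀ v, v ≠ s → v ≠ b → ¬ DirEdge f s v := by
  simp only [avoids, outFork, Set.mem_ofPred_eq, Prod.forall, Finset.mem_union,
    Finset.mem_product, Finset.mem_compl, Finset.mem_singleton, Finset.mem_insert, not_or]
  grind

lemma mem_avoids_inFork {f : Config N} {s a : Fin N} :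
    f ∈ avoids (inFork s a) ↔
      (∀ v, v ≠ a → ¬ DirEdge f v a) ∧ ∀ v, v ≠ s → v ≠ a → ¬ DirEdge f v s := by
  simp only [avoids, inFork, Set.mem_ofPred_eq, Prod.forall, Finset.mem_union,
    Finset.mem_product, Finset.mem_compl, Finset.mem_singleton, Finset.mem_insert, not_or]
  grind

lemma avoids_outStar_subset {s a : Fin N} (hsa : s ≠ a) :
    avoids (outStar s) ⊆ {f | ¬ Reaches f s a} := fun f hf =>
  not_reaches_of_closed (S := {s}) (by simp) (by simpa using hsa.symm) (by
    have := mem_avoids_outStar.1 hf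
    simpa using this)

lemma avoids_inStar_subset {s a : Fin N} (hsa : s ≠ a) :
    avoids (inStar a) ⊆ {f | ¬ Reaches f s a} := fun f hf =>
  not_reaches_of_closed (S := {a}ᶜ) (by simpa using hsa) (by simp) (by
    have := mem_avoids_inStar.1 hf
    simpa using this)

lemma avoids_outFork_subset {s a b : Fin N} (hsa : s ≠ a) (hsb : s ≠ b) (hab : a ≠ b) :
    avoids (outFork s b) ⊆ {f | ¬ Reaches f s a ∧ ¬ Reaches f b s} := fun f hf => by
  obtain ⟨hb, hs⟩ := mem_avoids_outFork.1 hf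
  exact ⟨not_reaches_of_closed (S := {s, b}) (by simp) (by simp [hsa.symm, hab]) (by grind),
    not_reaches_of_closed (S := {b}) (by simp) (by simpa using hsb) (by grind)⟩

lemma avoids_inFork_subset {s a b : Fin N} (hsa : s ≠ a) (hsb : s ≠ b) (hab : a ≠ b) :
    avoids (inFork s a) ⊆ {f | ¬ Reaches f s a ∧ ¬ Reaches f b s} := fun f hf => by
  obtain ⟨ha, hs⟩ := mem_avoids_inFork.1 hf
  exact ⟨not_reaches_of_closed (S := {a}ᶜ) (by simpa using hsa) (by simp)
      (by simpa using ha),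
    not_reaches_of_closed (S := {s, a}ᶜ) (by simp [hsb.symm, hab.symm]) (by simp)
      (by simp only [Finset.mem_compl]; grind)⟩

lemma avoids_stars_subset {s a b : Fin N} (hsa : s ≠ a) (hsb : s ≠ b) :
    avoids (outStar b ∪ inStar a) ⊆ {f | ¬ Reaches f s a ∧ ¬ Reaches f b s} := fun _ hf =>
  ⟨avoids_inStar_subset hsa (avoids_anti Finset.subset_union_right hf),
    avoids_outStar_subset hsb.symm (avoids_anti Finset.subset_union_left hf)⟩

lemma not_reaches_subset {s a : Fin N} {K M : ℕ} (hKM : K ≤ M) :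
    {f | ¬ Reaches f s a} ⊆
      (avoids (outStar s) ∪ avoids (inStar a)) ∪ (midCut N K ∪ sparse N 2 M) := by
  intro f hf
  by_cases hmid : f ∈ midCut N K
  · exact Or.inr (Or.inl hmid)
  obtain ⟨S, hs, ha, hS⟩ := exists_closed_of_not_reaches hf
  rcases card_lt_or_of_notMem_midCut hmid hS with hc | hc
  · by_cases hx : ∃ x ∈ S, x ≠ s
    · obtain ⟨x, hx, hxs⟩ := hx
      exact Or.inr (Or.inr (mem_sparse_two (by omega) hxs hx hs true true (hS x hx) (hS s hs)))
    · push Not at hx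
      refine Or.inl (Or.inl (mem_avoids_outStar.2 fun v hv => hS s hs v fun h => hv (hx v h)))
  · have hS' : ∀ x ∈ Sᶜ, Quiet f false x Sᶜ := fun x hx v hv =>
      hS v (by simpa using hv) x (by simpa using hx)
    by_cases hx : ∃ x ∈ Sᶜ, x ≠ a
    · obtain ⟨x, hx, hxa⟩ := hx
      have ha' : a ∈ Sᶜ := by simpa using ha
      exact Or.inr (Or.inr (mem_sparse_two (by omega) hxa hx ha' false false
        (hS' x hx) (hS' a ha')))
    · push Not at hx
      refine Or.inl (Or.inr (mem_avoids_inStar.2 fun v hv => hS v ?_ a ha))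
      by_contra h
      exact hv (hx v (by simpa using h))

lemma not_reaches_and_not_reaches_subset {s a b : Fin N} (hsa : s ≠ a) (hsb : s ≠ b)
    (hab : a ≠ b) {K M : ℕ} (hKM : 2 * K ≤ M) :
    {f | ¬ Reaches f s a ∧ ¬ Reaches f b s} ⊆
      (avoids (outFork s b) ∪ avoids (inFork s a) ∪ avoids (outStar b ∪ inStar a)) ∪
        (midCut N K ∪ nearlyIsolated N M ∪ sparse N 3 M) := by
  intro f hf
  by_cases hmid : f ∈ midCut N K
  · exact Or.inr (Or.inl (Or.inl hmid))
  obtain ⟨S, hsS, haS, hS⟩ := exists_closed_of_not_reaches hf.1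
  obtain ⟨T, hbT, hsT, hT⟩ := exists_closed_of_not_reaches hf.2
  have outS : ∀ x ∈ S, Quiet f true x S := hS
  have outT : ∀ x ∈ T, Quiet f true x T := hT
  have inS : ∀ x ∈ Sᶜ, Quiet f false x Sᶜ := fun x hx v hv =>
    hS v (by simpa using hv) x (by simpa using hx)
  have inT : ∀ x ∈ Tᶜ, Quiet f false x Tᶜ := fun x hx v hv =>
    hT v (by simpa using hv) x (by simpa using hx)
  have haS' : a ∈ Sᶜ := by simpa using haS
  have hsT' : s ∈ Tᶜ := by simpa using hsT
  rcases card_lt_or_of_notMem_midCut hmid hS with hcS | hcS <;>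
    rcases card_lt_or_of_notMem_midCut hmid hT with hcT | hcT
  · have hW : (S ∪ T).card ≤ M := (Finset.card_union_le _ _).trans (by omega)
    have hq : ∀ x ∈ S ∪ T, Quiet f true x (S ∪ T) := fun x hx =>
      (Finset.mem_union.1 hx).elim (fun h => (outS x h).mono Finset.subset_union_left)
        (fun h => (outT x h).mono Finset.subset_union_right)
    have hsW : s ∈ S ∪ T := Finset.mem_union_left _ hsS
    have hbW : b ∈ S ∪ T := Finset.mem_union_right _ hbT
    by_cases hx : ∃ x ∈ S ∪ T, x ≠ s ∧ x ≠ b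
    · obtain ⟨x, hx, hxs, hxb⟩ := hx
      exact Or.inr (Or.inr (mem_sparse_three hW hxs hxb hsb hx hsW hbW true true true
        (hq x hx) (hq s hsW) (hq b hbW)))
    · push Not at hx
      exact Or.inl (Or.inl (Or.inl (mem_avoids_outFork.2
        ⟨fun v hv => hT b hbT v fun h => hv (hx v (Finset.mem_union_right _ h)
            fun hvs => hsT (hvs ▸ h)),
          fun v hv hv' => hS s hsS v fun h => hv' (hx v (Finset.mem_union_left _ h) hv)⟩)))
  · have hW : (S ∪ Tᶜ).card ≤ M := (Finset.card_union_le _ _).trans (by omega)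
    exact Or.inr (Or.inl (Or.inr ⟨S ∪ Tᶜ, hW, s, Finset.mem_union_left _ hsS,
      (outS s hsS).mono Finset.subset_union_left, (inT s hsT').mono Finset.subset_union_right⟩))
  · have hW : (Sᶜ ∪ T).card ≤ M := (Finset.card_union_le _ _).trans (by omega)
    have hqS : ∀ x ∈ Sᶜ, Quiet f false x (Sᶜ ∪ T) := fun x h =>
      (inS x h).mono Finset.subset_union_left
    have hqT : ∀ x ∈ T, Quiet f true x (Sᶜ ∪ T) := fun x h =>
      (outT x h).mono Finset.subset_union_right
    have haW : a ∈ Sᶜ ∪ T := Finset.mem_union_left _ haS'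
    have hbW : b ∈ Sᶜ ∪ T := Finset.mem_union_right _ hbT
    by_cases hx : ∃ x ∈ Sᶜ, x ≠ a
    · obtain ⟨x, hx, hxa⟩ := hx
      have hxW : x ∈ Sᶜ ∪ T := Finset.mem_union_left _ hx
      by_cases hxb : x = b
      · subst hxb
        exact Or.inr (Or.inl (Or.inr ⟨_, hW, x, hxW, hqT x hbT, hqS x hx⟩))
      · exact Or.inr (Or.inr (mem_sparse_three hW hxa hxb hab hxW haW hbW false false true
          (hqS x hx) (hqS a haS') (hqT b hbT)))
    by_cases hy : ∃ y ∈ T, y ≠ b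
    · obtain ⟨y, hy, hyb⟩ := hy
      have hyW : y ∈ Sᶜ ∪ T := Finset.mem_union_right _ hy
      by_cases hya : y = a
      · subst hya
        exact Or.inr (Or.inl (Or.inr ⟨_, hW, y, hyW, hqT y hy, hqS y haS'⟩))
      · exact Or.inr (Or.inr (mem_sparse_three hW hya hyb hab hyW haW hbW true false true
          (hqT y hy) (hqS a haS') (hqT b hbT)))
    have h1 : f ∈ avoids (outStar b) :=
      mem_avoids_outStar.2 fun v hv => hT b hbT v fun h => hy ⟨v, h, hv⟩
    have h2 : f ∈ avoids (inStar a) := mem_avoids_inStar.2 fun v hv h =>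
      hx ⟨v, Finset.mem_compl.2 fun hvS => hS v hvS a haS h, hv⟩
    exact Or.inl (Or.inr fun d hd => (Finset.mem_union.1 hd).elim (h1 d) (h2 d))
  · have hW : (Sᶜ ∪ Tᶜ).card ≤ M := (Finset.card_union_le _ _).trans (by omega)
    have hq : ∀ x ∈ Sᶜ ∪ Tᶜ, Quiet f false x (Sᶜ ∪ Tᶜ) := fun x hx =>
      (Finset.mem_union.1 hx).elim (fun h => (inS x h).mono Finset.subset_union_left)
        (fun h => (inT x h).mono Finset.subset_union_right)
    have haW : a ∈ Sᶜ ∪ Tᶜ := Finset.mem_union_left _ haS'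
    have hsW : s ∈ Sᶜ ∪ Tᶜ := Finset.mem_union_right _ hsT'
    by_cases hx : ∃ x ∈ Sᶜ ∪ Tᶜ, x ≠ s ∧ x ≠ a
    · obtain ⟨x, hx, hxs, hxa⟩ := hx
      exact Or.inr (Or.inr (mem_sparse_three hW hxs hxa hsa hx hsW haW false false false
        (hq x hx) (hq s hsW) (hq a haW)))
    · push Not at hx
      refine Or.inl (Or.inl (Or.inr (mem_avoids_inFork.2 ⟨fun v hv => hS v ?_ a haS,
        fun v hv hv' => hT v ?_ s hsT⟩))) <;> by_contra h
      · exact hv (hx v (Finset.mem_union_left _ (Finset.mem_compl.2 h)) fun hvs => h (hvs ▸ hsS))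
      · exact hv' (hx v (Finset.mem_union_right _ (Finset.mem_compl.2 h)) hv)

lemma outStar_inter_inStar_subset {s a : Fin N} (hsa : s ≠ a) {M : ℕ} (hM : 2 ≤ M) :
    avoids (outStar s) ∩ avoids (inStar a) ⊆ sparse N 2 M := by
  rintro f ⟨h1, h2⟩
  rw [mem_avoids_outStar] at h1
  rw [mem_avoids_inStar] at h2
  refine mem_sparse_two (W := {s, a}) ((Finset.card_le_two).trans hM) hsa (by simp) (by simp)
    true false (quiet_true.2 ?_) (quiet_false.2 ?_) <;> grind

lemma outFork_inter_inFork_subset {s a b : Fin N} (hsa : s ≠ a) (hsb : s ≠ b) (hab : a ≠ b)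
    {M : ℕ} (hM : 3 ≤ M) : avoids (outFork s b) ∩ avoids (inFork s a) ⊆ sparse N 3 M := by
  rintro f ⟨h1, h2⟩
  rw [mem_avoids_outFork] at h1
  rw [mem_avoids_inFork] at h2
  refine mem_sparse_three (W := {s, a, b}) ((Finset.card_le_three).trans hM) hsa hsb hab
    (by simp) (by simp) (by simp) true false true (quiet_true.2 ?_) (quiet_false.2 ?_)
    (quiet_true.2 ?_) <;> grind

lemma forks_inter_stars_subset {s a b : Fin N} (hsa : s ≠ a) (hsb : s ≠ b) (hab : a ≠ b)
    {M : ℕ} (hM : 3 ≤ M) :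
    (avoids (outFork s b) ∪ avoids (inFork s a)) ∩ avoids (outStar b ∪ inStar a) ⊆
      sparse N 3 M := by
  rintro f ⟨h, h'⟩
  have hb := mem_avoids_outStar.1 (avoids_anti Finset.subset_union_left h')
  have ha := mem_avoids_inStar.1 (avoids_anti Finset.subset_union_right h')
  have hW : ({s, a, b} : Finset (Fin N)).card ≤ M := (Finset.card_le_three).trans hM
  rcases h with h | h
  · rw [mem_avoids_outFork] at h
    refine mem_sparse_three hW hsa hsb hab (by simp) (by simp) (by simp) true false true
      (quiet_true.2 ?_) (quiet_false.2 ?_) (quiet_true.2 ?_) <;> grind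
  · rw [mem_avoids_inFork] at h
    refine mem_sparse_three hW hsa hsb hab (by simp) (by simp) (by simp) false false true
      (quiet_false.2 ?_) (quiet_false.2 ?_) (quiet_true.2 ?_) <;> grind

end Reachability

section MainEvents

variable {N : ℕ} {p : ℝ}

lemma PrGnp_outStar (s : Fin N) : PrGnp N p (avoids (outStar s)) = (1 - p / 2) ^ (N - 1) := by
  rw [PrGnp_avoids_eq_pow]
  · simp [outStar, Finset.card_compl]
  · rintro ⟨u, v⟩; simp only [outStar, Finset.mem_product, Finset.mem_singleton,
      Finset.mem_compl]; grind
  · rintro ⟨u, v⟩; simp only [outStar, Finset.mem_product, Finset.mem_singleton,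
      Finset.mem_compl, Prod.swap]; grind

lemma PrGnp_inStar (a : Fin N) : PrGnp N p (avoids (inStar a)) = (1 - p / 2) ^ (N - 1) := by
  rw [PrGnp_avoids_eq_pow]
  · simp [inStar, Finset.card_compl]
  · rintro ⟨u, v⟩; simp only [inStar, Finset.mem_product, Finset.mem_singleton,
      Finset.mem_compl]; grind
  · rintro ⟨u, v⟩; simp only [inStar, Finset.mem_product, Finset.mem_singleton,
      Finset.mem_compl, Prod.swap]; grind

lemma PrGnp_outFork {s b : Fin N} (hsb : s ≠ b) :
    PrGnp N p (avoids (outFork s b)) = (1 - p / 2) ^ (N - 1 + (N - 2)) := by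
  rw [PrGnp_avoids_eq_pow]
  · rw [outFork, Finset.card_union_of_disjoint]
    · simp only [Finset.card_product, Finset.card_compl, Finset.card_singleton,
        Finset.card_pair hsb, Fintype.card_fin, one_mul]
    · rw [Finset.disjoint_left]
      rintro ⟨u, v⟩; simp only [Finset.mem_product, Finset.mem_singleton]; grind
  · rintro ⟨u, v⟩; simp only [outFork, Finset.mem_union, Finset.mem_product,
      Finset.mem_singleton, Finset.mem_compl]; grind
  · rintro ⟨u, v⟩; simp only [outFork, Finset.mem_union, Finset.mem_product,
      Finset.mem_singleton, Finset.mem_compl, Finset.mem_insert, Prod.swap]; grind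

lemma PrGnp_inFork {s a : Fin N} (hsa : s ≠ a) :
    PrGnp N p (avoids (inFork s a)) = (1 - p / 2) ^ (N - 1 + (N - 2)) := by
  rw [PrGnp_avoids_eq_pow]
  · rw [inFork, Finset.card_union_of_disjoint]
    · simp only [Finset.card_product, Finset.card_compl, Finset.card_singleton,
        Finset.card_pair hsa, Fintype.card_fin, mul_one]
    · rw [Finset.disjoint_left]
      rintro ⟨u, v⟩; simp only [Finset.mem_product, Finset.mem_singleton]; grind
  · rintro ⟨u, v⟩; simp only [inFork, Finset.mem_union, Finset.mem_product,
      Finset.mem_singleton, Finset.mem_compl]; grind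
  · rintro ⟨u, v⟩; simp only [inFork, Finset.mem_union, Finset.mem_product,
      Finset.mem_singleton, Finset.mem_compl, Finset.mem_insert, Prod.swap]; grind

lemma PrGnp_stars {a b : Fin N} (hab : a ≠ b) :
    PrGnp N p (avoids (outStar b ∪ inStar a)) = (1 - p / 2) ^ (N - 1 + (N - 2)) := by
  have hU : outStar b ∪ inStar a =
      ({b} : Finset (Fin N)) ×ˢ {b}ᶜ ∪ ({a, b}ᶜ : Finset (Fin N)) ×ˢ {a} := by
    ext ⟨u, v⟩
    simp only [outStar, inStar, Finset.mem_union, Finset.mem_product, Finset.mem_singleton,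
      Finset.mem_compl, Finset.mem_insert]
    grind
  rw [hU, PrGnp_avoids_eq_pow]
  · rw [Finset.card_union_of_disjoint]
    · simp only [Finset.card_product, Finset.card_compl, Finset.card_singleton,
        Finset.card_pair hab, Fintype.card_fin, one_mul, mul_one]
    · rw [Finset.disjoint_left]
      rintro ⟨u, v⟩; simp only [Finset.mem_product, Finset.mem_singleton, Finset.mem_compl,
        Finset.mem_insert]; grind
  · rintro ⟨u, v⟩; simp only [Finset.mem_union, Finset.mem_product,
      Finset.mem_singleton, Finset.mem_compl, Finset.mem_insert]; grind
  · rintro ⟨u, v⟩; simp only [Finset.mem_union, Finset.mem_product,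
      Finset.mem_singleton, Finset.mem_compl, Finset.mem_insert, Prod.swap]; grind

lemma abs_PrGnp_not_reaches_sub_le (h0 : 0 ≤ p) (h1 : p ≤ 1) {s a : Fin N} (hsa : s ≠ a)
    {K M : ℕ} (hKM : K ≤ M) (hM : 2 ≤ M) :
    |PrGnp N p {f | ¬ Reaches f s a} - 2 * (1 - p / 2) ^ (N - 1)| ≤
      PrGnp N p (midCut N K) + PrGnp N p (sparse N 2 M) := by
  have hu := (PrGnp_mono h0 h1 (not_reaches_subset (N := N) (s := s) (a := a) hKM)).trans
    (PrGnp_union_le h0 h1 _ _)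
  have hl := PrGnp_mono h0 h1 (Set.union_subset (avoids_outStar_subset hsa)
    (avoids_inStar_subset hsa))
  have herr := PrGnp_union_le h0 h1 (midCut N K) (sparse N 2 M)
  have hie := PrGnp_union_add_inter (p := p) (avoids (outStar s)) (avoids (inStar a))
  have hi := PrGnp_mono h0 h1 (outStar_inter_inStar_subset hsa hM)
  have hi0 := PrGnp_nonneg h0 h1 (avoids (outStar s) ∩ avoids (inStar a))
  have hm0 := PrGnp_nonneg h0 h1 (midCut N K)
  rw [PrGnp_outStar, PrGnp_inStar] at hie
  rw [abs_le]
  constructor <;> linarith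

lemma abs_PrGnp_not_reaches_and_not_reaches_sub_le (h0 : 0 ≤ p) (h1 : p ≤ 1) {s a b : Fin N}
    (hsa : s ≠ a) (hsb : s ≠ b) (hab : a ≠ b) {K M : ℕ} (hKM : 2 * K ≤ M) (hM : 3 ≤ M) :
    |PrGnp N p {f | ¬ Reaches f s a ∧ ¬ Reaches f b s} -
        3 * (1 - p / 2) ^ (N - 1 + (N - 2))| ≤
      PrGnp N p (midCut N K) + PrGnp N p (nearlyIsolated N M) + 2 * PrGnp N p (sparse N 3 M) := by
  have hu := (PrGnp_mono h0 h1 (not_reaches_and_not_reaches_subset hsa hsb hab hKM)).trans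
    (PrGnp_union_le h0 h1 _ _)
  have hl := PrGnp_mono h0 h1 (Set.union_subset (Set.union_subset
    (avoids_outFork_subset hsa hsb hab) (avoids_inFork_subset hsa hsb hab))
    (avoids_stars_subset hsa hsb))
  have herr := PrGnp_union_le h0 h1 (midCut N K ∪ nearlyIsolated N M) (sparse N 3 M)
  have herr' := PrGnp_union_le h0 h1 (midCut N K) (nearlyIsolated N M)
  have hie := PrGnp_union_add_inter (p := p) (avoids (outFork s b)) (avoids (inFork s a))
  have hie' := PrGnp_union_add_inter (p := p) (avoids (outFork s b) ∪ avoids (inFork s a))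
    (avoids (outStar b ∪ inStar a))
  have hi := PrGnp_mono h0 h1 (outFork_inter_inFork_subset hsa hsb hab hM)
  have hi' := PrGnp_mono h0 h1 (forks_inter_stars_subset hsa hsb hab hM)
  have hi0 := PrGnp_nonneg h0 h1 (avoids (outFork s b) ∩ avoids (inFork s a))
  have hi0' := PrGnp_nonneg h0 h1 ((avoids (outFork s b) ∪ avoids (inFork s a)) ∩
    avoids (outStar b ∪ inStar a))
  have hm0 := PrGnp_nonneg h0 h1 (midCut N K)
  have hn0 := PrGnp_nonneg h0 h1 (nearlyIsolated N M)
  rw [PrGnp_outFork hsb, PrGnp_inFork hsa] at hie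
  rw [PrGnp_stars hab] at hie'
  rw [abs_le]
  constructor <;> linarith

end MainEvents

section Asymptotics

open scoped Topology

variable {p : ℝ}

lemma tendsto_pow_mul_pow_sub_div_pow {r x : ℝ} (hr : 0 < r) (hrx : r < x) (c M : ℕ) :
    Tendsto (fun N : ℕ => (N : ℝ) ^ c * r ^ (N - M) / x ^ N) atTop (𝓝 0) := by
  have hx : 0 < x := hr.trans hrx
  have h := (tendsto_pow_const_mul_const_pow_of_lt_one c (div_pos hr hx).le
    ((div_lt_one hx).2 hrx)).mul_const (r ^ M)⁻¹
  rw [zero_mul] at h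
  refine h.congr' ?_
  filter_upwards [eventually_ge_atTop M] with N hN
  rw [pow_sub₀ r hr.ne' hN, div_pow]
  ring

lemma tendsto_PrGnp_sparse_div_pow (h0 : 0 ≤ p) (h1 : p ≤ 1) {x : ℝ} (j M : ℕ)
    (hx : (1 - p / 2) ^ j < x) :
    Tendsto (fun N : ℕ => PrGnp N p (sparse N j M) / x ^ N) atTop (𝓝 0) := by
  have hq : 0 < (1 - p / 2) ^ j := pow_pos (by linarith) _
  have h := (tendsto_pow_mul_pow_sub_div_pow hq hx (M + j) M).const_mul ((2 : ℝ) ^ j)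
  rw [mul_zero] at h
  refine squeeze_zero' (Eventually.of_forall fun N => ?_) ?_ h
  · exact div_nonneg (PrGnp_nonneg h0 h1 _) (pow_nonneg (hq.trans hx).le _)
  · filter_upwards [eventually_ge_atTop 1] with N hN
    have : Nonempty (Fin N) := ⟨⟨0, hN⟩⟩
    have hxN : 0 < x ^ N := pow_pos (hq.trans hx) _
    rw [← mul_div_assoc]
    refine div_le_div_of_nonneg_right ((PrGnp_sparse_le h0 h1 j M).trans_eq ?_) hxN.le
    rw [pow_mul]
    ring

lemma tendsto_PrGnp_nearlyIsolated_div_pow (h0 : 0 ≤ p) (h1 : p ≤ 1) {t x : ℝ} (M : ℕ)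
    (ht0 : 0 < t) (ht1 : t ≤ 1) (ht : 1 - p ≤ t ^ 2) (hx : t ^ 2 < x) :
    Tendsto (fun N : ℕ => PrGnp N p (nearlyIsolated N M) / x ^ N) atTop (𝓝 0) := by
  have hq : 0 < t ^ 2 := pow_pos ht0 _
  refine squeeze_zero' (Eventually.of_forall fun N => ?_) ?_
    (tendsto_pow_mul_pow_sub_div_pow hq hx (M + 1) M)
  · exact div_nonneg (PrGnp_nonneg h0 h1 _) (pow_nonneg (hq.trans hx).le _)
  · filter_upwards [eventually_ge_atTop 1] with N hN
    have : Nonempty (Fin N) := ⟨⟨0, hN⟩⟩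
    have hxN : 0 < x ^ N := pow_pos (hq.trans hx) _
    refine div_le_div_of_nonneg_right
      ((PrGnp_nearlyIsolated_le h0 h1 ht0.le ht1 ht M).trans_eq ?_) hxN.le
    rw [pow_mul]
    ring

lemma tendsto_PrGnp_midCut_div_pow (h0 : 0 ≤ p) (h1 : p ≤ 1) {x : ℝ} (K : ℕ)
    (hx : 2 * (1 - p / 2) ^ K < x) :
    Tendsto (fun N : ℕ => PrGnp N p (midCut N K) / x ^ N) atTop (𝓝 0) := by
  have hq : 0 < 2 * (1 - p / 2) ^ K := mul_pos two_pos (pow_pos (by linarith) _)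
  have h := (tendsto_pow_mul_pow_sub_div_pow hq hx 0 K).const_mul ((2 : ℝ) ^ K)
  rw [mul_zero] at h
  refine squeeze_zero' (Eventually.of_forall fun N => ?_) ?_ h
  · exact div_nonneg (PrGnp_nonneg h0 h1 _) (pow_nonneg (hq.trans hx).le _)
  · filter_upwards [eventually_ge_atTop K] with N hN
    have hxN : 0 < x ^ N := pow_pos (hq.trans hx) _
    rw [← mul_div_assoc]
    refine div_le_div_of_nonneg_right ((PrGnp_midCut_le h0 h1 K).trans_eq ?_) hxN.le
    obtain ⟨m, rfl⟩ := Nat.exists_eq_add_of_le hN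
    rw [Nat.add_sub_cancel_left, pow_mul, pow_add, mul_pow]
    ring

lemma exists_two_mul_pow_lt {q : ℝ} (hq0 : 0 < q) (hq1 : q < 1) :
    ∃ K : ℕ, 2 ≤ K ∧ 2 * q ^ K < q ^ 2 := by
  have h := (tendsto_pow_atTop_nhds_zero_of_lt_one hq0.le hq1).const_mul 2
  rw [mul_zero] at h
  obtain ⟨K, hK, hK2⟩ := ((h.eventually_lt_const (pow_pos hq0 2)).and
    (eventually_ge_atTop 2)).exists
  exact ⟨K, hK2, hK⟩

lemma tendsto_PrGnp_not_reaches_div_pow (h0 : 0 < p) (h1 : p ≤ 1) (s a : (n : ℕ) → Fin (n + 3))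
    (hsa : ∀ n, s n ≠ a n) :
    Tendsto (fun n : ℕ => PrGnp (n + 3) p {f | ¬ Reaches f (s n) (a n)} / (1 - p / 2) ^ (n + 3))
      atTop (𝓝 (2 / (1 - p / 2))) := by
  have hq0 : 0 < 1 - p / 2 := by linarith
  have hq1 : 1 - p / 2 < 1 := by linarith
  have hq2 : (1 - p / 2) ^ 2 < 1 - p / 2 := by nlinarith
  obtain ⟨K, hK2, hK⟩ := exists_two_mul_pow_lt hq0 hq1
  have herr := (tendsto_add_atTop_iff_nat 3).2
    ((tendsto_PrGnp_midCut_div_pow h0.le h1 K (hK.trans hq2)).add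
      (tendsto_PrGnp_sparse_div_pow h0.le h1 2 K hq2))
  rw [add_zero] at herr
  rw [tendsto_iff_norm_sub_tendsto_zero]
  refine squeeze_zero (fun _ => norm_nonneg _) (fun n => ?_) herr
  have hqn : 0 < (1 - p / 2) ^ (n + 3) := pow_pos hq0 _
  have h := abs_PrGnp_not_reaches_sub_le h0.le h1 (hsa n) le_rfl hK2
  rw [Real.norm_eq_abs, ← add_div, le_div_iff₀ hqn, ← abs_of_pos hqn, ← abs_mul, sub_mul,
    abs_of_pos hqn, div_mul_cancel₀ _ hqn.ne']
  have hpow : 2 / (1 - p / 2) * (1 - p / 2) ^ (n + 3) = 2 * (1 - p / 2) ^ (n + 3 - 1) := by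
    have hne := hq0.ne'
    rw [show n + 3 - 1 = n + 2 by omega]
    generalize 1 - p / 2 = q at hne ⊢
    field_simp
    ring
  rwa [hpow]

lemma tendsto_PrGnp_not_reaches_and_not_reaches_div_pow (h0 : 0 < p) (h1 : p ≤ 1)
    (s a b : (n : ℕ) → Fin (n + 3)) (hsa : ∀ n, s n ≠ a n) (hsb : ∀ n, s n ≠ b n)
    (hab : ∀ n, a n ≠ b n) :
    Tendsto (fun n : ℕ => PrGnp (n + 3) p {f | ¬ Reaches f (s n) (a n) ∧ ¬ Reaches f (b n) (s n)} /
      ((1 - p / 2) ^ 2) ^ (n + 3)) atTop (𝓝 (3 / (1 - p / 2) ^ 3)) := by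
  have hq0 : 0 < 1 - p / 2 := by linarith
  have hq1 : 1 - p / 2 < 1 := by linarith
  have hq3 : (1 - p / 2) ^ 3 < (1 - p / 2) ^ 2 := pow_lt_pow_right_of_lt_one₀ hq0 hq1 (by omega)
  obtain ⟨K, hK2, hK⟩ := exists_two_mul_pow_lt hq0 hq1
  have hpos : 0 < (1 - p / 2) ^ 2 - p ^ 2 / 8 := by nlinarith
  have ht : √((1 - p / 2) ^ 2 - p ^ 2 / 8) ^ 2 = (1 - p / 2) ^ 2 - p ^ 2 / 8 :=
    Real.sq_sqrt hpos.le
  have herr := (tendsto_add_atTop_iff_nat 3).2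
    (((tendsto_PrGnp_midCut_div_pow h0.le h1 K hK).add
      (tendsto_PrGnp_nearlyIsolated_div_pow h0.le h1 (x := (1 - p / 2) ^ 2) (2 * K)
        (Real.sqrt_pos.2 hpos) (Real.sqrt_le_one.2 (by nlinarith)) (by nlinarith)
        (by nlinarith))).add
      ((tendsto_PrGnp_sparse_div_pow h0.le h1 3 (2 * K) hq3).const_mul 2))
  rw [mul_zero, add_zero, add_zero] at herr
  rw [tendsto_iff_norm_sub_tendsto_zero]
  refine squeeze_zero (fun _ => norm_nonneg _) (fun n => ?_) herr
  have hqn : 0 < ((1 - p / 2) ^ 2) ^ (n + 3) := pow_pos (pow_pos hq0 _) _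
  have h := abs_PrGnp_not_reaches_and_not_reaches_sub_le h0.le h1 (hsa n) (hsb n) (hab n)
    (M := 2 * K) le_rfl (by omega)
  rw [Real.norm_eq_abs, ← mul_div_assoc, ← add_div, ← add_div, le_div_iff₀ hqn,
    ← abs_of_pos hqn, ← abs_mul, sub_mul, abs_of_pos hqn, div_mul_cancel₀ _ hqn.ne']
  have hpow : 3 / (1 - p / 2) ^ 3 * ((1 - p / 2) ^ 2) ^ (n + 3) =
      3 * (1 - p / 2) ^ (n + 3 - 1 + (n + 3 - 2)) := by
    have hne := hq0.ne'
    rw [show n + 3 - 1 + (n + 3 - 2) = 2 * n + 3 by omega]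
    generalize 1 - p / 2 = q at hne ⊢
    field_simp
    ring
  rwa [hpow]

lemma tendsto_covariance_div_pow (h0 : 0 < p) (h1 : p ≤ 1)
    (s a b : (n : ℕ) → Fin (n + 3)) (hsa : ∀ n, s n ≠ a n) (hsb : ∀ n, s n ≠ b n)
    (hab : ∀ n, a n ≠ b n) :
    Tendsto (fun n : ℕ =>
      (PrGnp (n + 3) p {f | ¬ Reaches f (s n) (a n) ∧ ¬ Reaches f (b n) (s n)} -
        PrGnp (n + 3) p {f | ¬ Reaches f (s n) (a n)} *
          PrGnp (n + 3) p {f | ¬ Reaches f (b n) (s n)}) / ((1 - p / 2) ^ 2) ^ (n + 3))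
      atTop (𝓝 ((2 * p - 1) / (1 - p / 2) ^ 3)) := by
  have hq0 : 0 < 1 - p / 2 := by linarith
  have h := (tendsto_PrGnp_not_reaches_and_not_reaches_div_pow h0 h1 s a b hsa hsb hab).sub
    ((tendsto_PrGnp_not_reaches_div_pow h0 h1 s a hsa).mul
      (tendsto_PrGnp_not_reaches_div_pow h0 h1 b s fun n => (hsb n).symm))
  have hlim : (2 * p - 1) / (1 - p / 2) ^ 3 =
      3 / (1 - p / 2) ^ 3 - 2 / (1 - p / 2) * (2 / (1 - p / 2)) := by
    field_simp
    ring
  rw [hlim]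
  refine h.congr fun n => ?_
  rw [div_mul_div_comm, ← sq, ← pow_mul, ← pow_mul, mul_comm 2 (n + 3), sub_div]

end Asymptotics

/-- Fix `p ∈ (0,1]` and distinct vertices `s, a, b` of `⃗G(n,p)`.
If `0 < p < 1/2` then `Cov({s ↛ a}, {b ↛ s}) < 0` for all sufficiently large `n`;
if `1/2 < p ≤ 1` then `Cov({s ↛ a}, {b ↛ s}) > 0` for all sufficiently large `n`. -/
theorem gnp_covariance_sign
    (p : ℝ) (hp : p ∈ Set.Ioc (0 : ℝ) 1)
    (s a b : (n : ℕ) → Fin (n + 3))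
    (hsa : ∀ n, s n ≠ a n) (hsb : ∀ n, s n ≠ b n) (hab : ∀ n, a n ≠ b n) :
    (p < 1 / 2 →
      ∀ᶠ n : ℕ in Filter.atTop,
        PrGnp (n + 3) p {f | ¬ Reaches f (s n) (a n) ∧ ¬ Reaches f (b n) (s n)} -
            PrGnp (n + 3) p {f | ¬ Reaches f (s n) (a n)} *
              PrGnp (n + 3) p {f | ¬ Reaches f (b n) (s n)} < 0) ∧
    (1 / 2 < p →
      ∀ᶠ n : ℕ in Filter.atTop,
        0 < PrGnp (n + 3) p {f | ¬ Reaches f (s n) (a n) ∧ ¬ Reaches f (b n) (s n)} -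
            PrGnp (n + 3) p {f | ¬ Reaches f (s n) (a n)} *
              PrGnp (n + 3) p {f | ¬ Reaches f (b n) (s n)}) := by
  have hq0 : 0 < 1 - p / 2 := by linarith [hp.2]
  have h := tendsto_covariance_div_pow hp.1 hp.2 s a b hsa hsb hab
  have hpos : ∀ n : ℕ, 0 < ((1 - p / 2) ^ 2) ^ (n + 3) := fun n => pow_pos (pow_pos hq0 _) _
  constructor
  · intro hlt
    filter_upwards [h.eventually_lt_const
      (div_neg_of_neg_of_pos (by linarith) (pow_pos hq0 3))] with n hn
    simpa using (div_lt_iff₀ (hpos n)).1 hn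
  · intro hlt
    filter_upwards [h.eventually_const_lt
      (div_pos (by linarith) (pow_pos hq0 3))] with n hn
    simpa using (lt_div_iff₀ (hpos n)).1 hn
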